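/- arXiv:2211.12397 — 3 statements merged into one kernel-verified Lean document; each statement's English description precedes it below -/
import Mathlib

section
/- Let (s_k) be a sequence of positive integers, let 1 ≤ i < j, and set n = |α_i^{(s)}| (n is even). For any position p with p + n ≤ |α_j^{(s)}|: if the block ((α_j^{(s)}).drop p).take n equals α_i^{(s)}, then either n divides p, or p mod n = n/2 and the block of length 2n starting at position p − n/2 (i.e. ((α_j^{(s)}).drop (p − n/2)).take (2n)) equals ᾱ_i^{(s)} ++ ᾱ_i^{(s)}. Conversely, if p mod n = n/2 and ((α_j^{(s)}).drop (p − n/2)).take (2n) = ᾱ_i^{(s)} ++ ᾱ_i^{(s)}, then ((α_j^{(s)}).drop p).take n = α_i^{(s)}. -/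
/-- The complement of a binary word: negate every letter. -/
def wordCompl (w : List Bool) : List Bool := w.map Bool.not

/-- `wordPow u k` is the concatenation of `k` copies of `u`. -/
def wordPow (u : List Bool) (k : ℕ) : List Bool := (List.replicate k u).flatten

/-- Pouzet's words `α_i^{(s)}`: `α_1 = [0,1]`, `α_{i+1} = α_i^{s_i} ++ ᾱ_i^{s_i}`. -/
def alphaWord (s : ℕ → ℕ) : ℕ → List Bool
  | 0 => []
  | 1 => [false, true]
  | (i + 2) => wordPow (alphaWord s (i + 1)) (s (i + 1)) ++
      wordPow (wordCompl (alphaWord s (i + 1))) (s (i + 1))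

/-- The language `L^{(s)}` of all factors of the words `α_i^{(s)}`, `i ≥ 1`. -/
def langL (s : ℕ → ℕ) : Set (List Bool) :=
  {w | ∃ i, 1 ≤ i ∧ w <:+: alphaWord s i}


def aLen (s : ℕ → ℕ) : ℕ → ℕ
  | 0 => 0
  | 1 => 2
  | (i + 2) => aLen s (i + 1) * (2 * s (i + 1))

def aFun (s : ℕ → ℕ) : ℕ → ℕ → Bool
  | 0, _ => false
  | 1, x => decide (x = 1)
  | (i + 2), x => xor (decide (s (i + 1) ≤ x / aLen s (i + 1)))
      (aFun s (i + 1) (x % aLen s (i + 1)))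

theorem aLen_pos (s : ℕ → ℕ) (hs : ∀ k, 0 < s k) (i : ℕ) : 0 < aLen s (i + 1) := by
  induction i with
  | zero => simp [aLen]
  | succ i ih =>
    have := hs (i + 1)
    simp only [aLen]; positivity

theorem aLen_even (s : ℕ → ℕ) (i : ℕ) : Even (aLen s (i + 1)) := by
  cases i with
  | zero => simp [aLen]
  | succ i => simp [aLen]

theorem wordPow_length (u : List Bool) (k : ℕ) : (wordPow u k).length = u.length * k := by
  simp [wordPow, mul_comm]

theorem wordPow_getD (u : List Bool) (k x : ℕ) (hx : x < u.length * k) :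
    (wordPow u k).getD x false = u.getD (x % u.length) false := by
  induction k generalizing x with
  | zero => simp at hx
  | succ k ih =>
    have e : wordPow u (k + 1) = u ++ wordPow u k := by
      simp [wordPow, List.replicate_succ]
    rw [e]
    by_cases h : x < u.length
    · rw [List.getD_append _ _ _ _ h, Nat.mod_eq_of_lt h]
    · push Not at h
      rw [List.getD_append_right _ _ _ _ h, ih _ (by rw [mul_add] at hx; omega),
        ← Nat.mod_eq_sub_mod h]

theorem wordCompl_length (u : List Bool) : (wordCompl u).length = u.length := by
  simp [wordCompl]

theorem wordCompl_getD (u : List Bool) (x : ℕ) (hx : x < u.length) :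
    (wordCompl u).getD x false = !(u.getD x false) := by
  simp [wordCompl, hx]

theorem alpha_spec (s : ℕ → ℕ) (hs : ∀ k, 0 < s k) (i : ℕ) :
    (alphaWord s (i + 1)).length = aLen s (i + 1) ∧
    ∀ x < aLen s (i + 1), (alphaWord s (i + 1)).getD x false = aFun s (i + 1) x := by
  induction i with
  | zero =>
    refine ⟨rfl, ?_⟩
    intro x hx
    simp only [aLen, zero_add] at hx
    interval_cases x <;> rfl
  | succ i ih =>
    obtain ⟨h1, h2⟩ := ih
    have hpos := aLen_pos s hs i
    refine ⟨?_, ?_⟩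
    · simp only [alphaWord, aLen, List.length_append, wordPow_length, wordCompl_length, h1]
      ring
    · intro x hx
      simp only [alphaWord, aFun]
      simp only [aLen] at hx
      by_cases h : x < aLen s (i + 1) * s (i + 1)
      · rw [List.getD_append _ _ _ _ (by rw [wordPow_length, h1]; exact h),
          wordPow_getD _ _ _ (by rw [h1]; exact h), h1, h2 _ (Nat.mod_lt _ hpos)]
        have : ¬ (s (i + 1) ≤ x / aLen s (i + 1)) := by
          rw [Nat.le_div_iff_mul_le hpos, mul_comm]; omega
        simp [this]
      · push Not at h
        have h3 : x - aLen s (i + 1) * s (i + 1) < aLen s (i + 1) * s (i + 1) := by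
          have : aLen s (i + 1) * (2 * s (i + 1)) = 2 * (aLen s (i + 1) * s (i + 1)) := by ring
          omega
        rw [List.getD_append_right _ _ _ _ (by rw [wordPow_length, h1]; exact h),
          wordPow_length, h1,
          wordPow_getD _ _ _ (by rw [wordCompl_length, h1]; exact h3),
          wordCompl_length, h1, wordCompl_getD _ _ (by rw [h1]; exact Nat.mod_lt _ hpos),
          h2 _ (Nat.mod_lt _ hpos)]
        have : (s (i + 1) ≤ x / aLen s (i + 1)) := by
          rw [Nat.le_div_iff_mul_le hpos, mul_comm]; omega
        have e : (x - aLen s (i + 1) * s (i + 1)) % aLen s (i + 1) = x % aLen s (i + 1) :=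
          Nat.sub_mul_mod h
        simp [this, e]

theorem aFun_half (s : ℕ → ℕ) (hs : ∀ k, 0 < s k) (i x : ℕ) (hx : x < aLen s (i + 1) / 2) :
    aFun s (i + 1) (x + aLen s (i + 1) / 2) = !(aFun s (i + 1) x) := by
  cases i with
  | zero =>
    have : x = 0 := by simpa [aLen] using hx
    subst this; simp [aFun, aLen]
  | succ i =>
    have hpos := aLen_pos s hs i
    have e : aLen s (i + 1 + 1) / 2 = aLen s (i + 1) * s (i + 1) := by
      simp only [aLen]
      rw [show aLen s (i + 1) * (2 * s (i + 1)) = 2 * (aLen s (i + 1) * s (i + 1)) by ring]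
      omega
    rw [e] at hx ⊢
    simp only [aFun]
    rw [Nat.add_mul_mod_self_left, Nat.add_mul_div_left _ _ hpos]
    have : ¬ (s (i + 1) ≤ x / aLen s (i + 1)) := by
      rw [Nat.le_div_iff_mul_le hpos, mul_comm]; omega
    simp [this]

theorem aFun_blocks (s : ℕ → ℕ) (i d : ℕ) :
    (∃ M, aLen s (i + 1 + d) = aLen s (i + 1) * M) ∧
    ∃ g : ℕ → Bool, ∀ x < aLen s (i + 1 + d), aFun s (i + 1 + d) x =
      xor (g (x / aLen s (i + 1))) (aFun s (i + 1) (x % aLen s (i + 1))) := by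
  induction d with
  | zero =>
    refine ⟨⟨1, by simp⟩, fun _ => false, ?_⟩
    intro x hx
    simp [Nat.mod_eq_of_lt hx]
  | succ d ih =>
    obtain ⟨⟨M, hM⟩, g, hg⟩ := ih
    rw [show i + 1 + d = i + d + 1 by ring] at hM hg
    rw [show i + 1 + (d + 1) = i + d + 2 by ring]
    refine ⟨⟨M * (2 * s (i + d + 1)), by simp only [aLen, hM]; ring⟩,
      fun q => xor (decide (s (i + d + 1) ≤ q / M)) (g (q % M)), ?_⟩
    intro x hx
    have hpos : 0 < aLen s (i + d + 1) := by
      simp only [aLen] at hx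
      exact Nat.pos_of_mul_pos_right (by omega : 0 < aLen s (i + d + 1) * (2 * s (i + d + 1)))
    simp only [aFun]
    rw [hg _ (Nat.mod_lt _ hpos), hM, Nat.mod_mul_right_div_self, Nat.mod_mul_right_mod,
      ← Nat.div_div_eq_div_mul]
    simp

theorem key (s : ℕ → ℕ) (hs : ∀ k, 0 < s k) (i : ℕ) : ∀ (g : ℕ → Bool) (p : ℕ),
    (∀ t < aLen s (i + 1), xor (g ((p + t) / aLen s (i + 1)))
      (aFun s (i + 1) ((p + t) % aLen s (i + 1))) = aFun s (i + 1) t) →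
    (p % aLen s (i + 1) = 0 ∧ g (p / aLen s (i + 1)) = false) ∨
    (p % aLen s (i + 1) = aLen s (i + 1) / 2 ∧ g (p / aLen s (i + 1)) = true ∧
      g (p / aLen s (i + 1) + 1) = true) := by
  induction i with
  | zero =>
    intro g p h
    rw [show aLen s (0 + 1) = 2 from rfl] at h ⊢
    simp only [aFun] at h ⊢
    have h0 := h 0 (by omega)
    have h1 := h 1 (by omega)
    rcases Nat.mod_two_eq_zero_or_one p with hp | hp
    · left
      simpa [hp] using h0
    · right
      have e1 : (p + 1) / 2 = p / 2 + 1 := by omega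
      have e2 : (p + 1) % 2 = 0 := by omega
      rw [e1] at h1
      simp [hp, e2] at h0 h1 ⊢
      exact ⟨h0, h1⟩
  | succ i ih =>
    intro g p h
    have hpos := aLen_pos s hs i
    have hS := hs (i + 1)
    rw [show aLen s (i + 1 + 1) = aLen s (i + 1) * (2 * s (i + 1)) from rfl] at h ⊢
    simp only [aFun] at h
    set n := aLen s (i + 1) with hn
    set S := s (i + 1) with hSd
    set a := aFun s (i + 1) with ha
    set g' : ℕ → Bool := fun q => xor (g (q / (2 * S))) (decide (S ≤ q % (2 * S))) with hg'
    have h' : ∀ k < 2 * S, ∀ u < n,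
        xor (xor (g' ((p + k * n + u) / n)) (decide (S ≤ k))) (a ((p + k * n + u) % n)) = a u := by
      intro k hk u hu
      have hlt : k * n + u < n * (2 * S) := by nlinarith
      have := h (k * n + u) hlt
      rw [← add_assoc, Nat.mod_mul_right_div_self, Nat.mod_mul_right_mod,
        ← Nat.div_div_eq_div_mul, Nat.add_comm (k * n) u, Nat.add_mul_div_right _ _ hpos,
        Nat.add_mul_mod_self_right, Nat.mod_eq_of_lt hu, Nat.div_eq_of_lt hu, zero_add] at this
      simp only [hg']
      revert this
      generalize g _ = b1
      generalize a u = b2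
      generalize a _ = b3
      generalize decide (S ≤ k) = b4
      generalize decide (S ≤ _) = b5
      revert b1 b2 b3 b4 b5
      decide
    have h2 : ∀ k < 2 * S, (p % n = 0 ∧ g' (p / n + k) = decide (S ≤ k)) ∨
        (p % n = n / 2 ∧ g' (p / n + k) = !decide (S ≤ k) ∧
          g' (p / n + k + 1) = !decide (S ≤ k)) := by
      intro k hk
      have := ih (fun q => xor (g' q) (decide (S ≤ k))) (p + k * n) (h' k hk)
      rw [Nat.add_mul_mod_self_right, Nat.add_mul_div_right _ _ hpos] at this
      refine this.imp (fun h => ⟨h.1, ?_⟩) (fun h => ⟨h.1, ?_, ?_⟩)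
      · have := h.2
        revert this
        generalize g' _ = b1
        generalize decide (S ≤ k) = b2
        revert b1 b2
        decide
      · have := h.2.1
        revert this
        generalize g' _ = b1
        generalize decide (S ≤ k) = b2
        revert b1 b2
        decide
      · have := h.2.2
        revert this
        generalize g' _ = b1
        generalize decide (S ≤ k) = b2
        revert b1 b2
        decide
    have hn2 : 0 < n / 2 := by
      obtain ⟨c, hc⟩ := aLen_even s i
      omega
    have hp0 : p % n = 0 := by
      by_contra hne
      have ha1 := h2 (S - 1) (by omega)
      have ha2 := h2 S (by omega)
      rw [show p / n + (S - 1) + 1 = p / n + S by omega] at ha1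
      have : ¬ (S ≤ S - 1) := by omega
      simp [hne, this] at ha1 ha2
      have := ha1.2.2
      have := ha2.2.1
      simp_all
    have h3 : ∀ k < 2 * S, g' (p / n + k) = decide (S ≤ k) := by
      intro k hk
      rcases h2 k hk with h | h
      · exact h.2
      · omega
    have hpn : p = n * (p / n) := by
      have := Nat.div_add_mod p n
      omega
    have hmod : p % (n * (2 * S)) = n * ((p / n) % (2 * S)) := by
      conv_lhs => rw [hpn]
      rw [Nat.mul_mod_mul_left]
    rw [hmod, ← Nat.div_div_eq_div_mul]
    have hhalf : n * (2 * S) / 2 = n * S := by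
      rw [show n * (2 * S) = 2 * (n * S) by ring]; omega
    rw [hhalf]
    generalize p / n = P at h3 ⊢
    obtain ⟨c, hc⟩ : ∃ c, c = P % (2 * S) := ⟨_, rfl⟩
    obtain ⟨Q, hQ⟩ : ∃ Q, Q = P / (2 * S) := ⟨_, rfl⟩
    have hcl : c < 2 * S := by rw [hc]; exact Nat.mod_lt _ (by omega)
    have hP : P = c + 2 * S * Q := by rw [hc, hQ]; exact (Nat.mod_add_div _ _).symm
    rw [← hc, ← hQ]
    have hA : ∀ k, c + k < 2 * S → xor (g Q) (decide (S ≤ c + k)) = decide (S ≤ k) := by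
      intro k hk
      have := h3 k (by omega)
      simp only [hg'] at this
      rw [hP, show c + 2 * S * Q + k = c + k + 2 * S * Q by ring,
        Nat.add_mul_div_left _ _ (by omega), Nat.add_mul_mod_self_left, Nat.mod_eq_of_lt hk,
        Nat.div_eq_of_lt hk, zero_add] at this
      exact this
    have hB : ∀ r, r < c → xor (g (Q + 1)) (decide (S ≤ r)) = decide (S ≤ r + 2 * S - c) := by
      intro r hr
      have := h3 (r + 2 * S - c) (by omega)
      simp only [hg'] at this
      rw [hP, show c + 2 * S * Q + (r + 2 * S - c) = r + 2 * S * (Q + 1) by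
          rw [mul_add]; omega,
        Nat.add_mul_div_left _ _ (by omega), Nat.add_mul_mod_self_left,
        Nat.mod_eq_of_lt (by omega : r < 2 * S),
        Nat.div_eq_of_lt (by omega : r < 2 * S), zero_add] at this
      exact this
    have hA0 := hA 0 (by omega)
    have hS0 : ¬ (S ≤ 0) := by omega
    rcases Nat.eq_zero_or_pos c with h0 | h0
    · left
      subst h0
      simpa [hS0] using hA0
    · rcases lt_trichotomy c S with hlt | heq | hgt
      · exfalso
        have h5 := hA (S - c) (by omega)
        have e1 : S ≤ c + (S - c) := by omega
        have e2 : ¬ (S ≤ S - c) := by omega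
        have e3 : ¬ (S ≤ c + 0) := by omega
        simp only [e1, e2, e3, hS0] at h5 hA0
        revert h5 hA0
        generalize g _ = b
        revert b
        decide
      · right
        have h5 := hB 0 h0
        have e1 : S ≤ 0 + 2 * S - c := by omega
        have e3 : S ≤ c + 0 := by omega
        simp only [e1, e3, hS0] at h5 hA0
        refine ⟨by rw [heq], by simpa using hA0, by simpa using h5⟩
      · exfalso
        have h5 := hB 0 h0
        have h6 := hB (c - S) (by omega)
        have e1 : ¬ (S ≤ 0 + 2 * S - c) := by omega
        have e2 : S ≤ c - S + 2 * S - c := by omega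
        have e3 : ¬ (S ≤ c - S) := by omega
        simp only [e1, e2, e3, hS0] at h5 h6
        revert h5 h6
        generalize g _ = b
        revert b
        decide

theorem block_iff (W V : List Bool) (p m : ℕ) (hW : p + m ≤ W.length) (hV : V.length = m) :
    (W.drop p).take m = V ↔ ∀ t < m, W.getD (p + t) false = V.getD t false := by
  constructor
  · intro h t ht
    rw [← h]
    have : p + t < W.length := by omega
    simp [List.getD, ht, List.getElem?_take, List.getElem?_drop]
  · intro h
    apply List.ext_getElem
    · simp; omega
    · intro t h1 h2
      have := h t (by omega)
      have : p + t < W.length := by omega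
      have : t < V.length := by omega
      simp_all

theorem alphaWord_embeddings (s : ℕ → ℕ) (hs : ∀ k, 0 < s k) (i j : ℕ) (hi : 1 ≤ i)
    (hij : i < j) (n : ℕ) (hn : n = (alphaWord s i).length) (p : ℕ)
    (hp : p + n ≤ (alphaWord s j).length) :
    Even n ∧
    (((alphaWord s j).drop p).take n = alphaWord s i →
      n ∣ p ∨ (p % n = n / 2 ∧
        ((alphaWord s j).drop (p - n / 2)).take (2 * n) =
          wordCompl (alphaWord s i) ++ wordCompl (alphaWord s i))) ∧
    ((p % n = n / 2 ∧
        ((alphaWord s j).drop (p - n / 2)).take (2 * n) =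
          wordCompl (alphaWord s i) ++ wordCompl (alphaWord s i)) →
      ((alphaWord s j).drop p).take n = alphaWord s i) := by
  obtain ⟨i, rfl⟩ : ∃ k, i = k + 1 := ⟨i - 1, by omega⟩
  obtain ⟨d, rfl⟩ : ∃ d, j = i + 1 + d := ⟨j - (i + 1), by omega⟩
  obtain ⟨hl, hA⟩ := alpha_spec s hs i
  obtain ⟨hlj, hAj⟩ := alpha_spec s hs (i + d)
  obtain ⟨⟨M, hM⟩, g, hg⟩ := aFun_blocks s i d
  rw [show i + d + 1 = i + 1 + d by ring] at hlj hAj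
  have hhalf := aFun_half s hs i
  have hkey := key s hs i
  have hev := aLen_even s i
  have hpos := aLen_pos s hs i
  rw [hl] at hn
  rw [← hn] at *
  rw [hlj] at hp
  have hdm := Nat.mod_add_div p n
  have hlen2 : p % n = n / 2 → p - n / 2 + 2 * n ≤ n * M := by
    intro h
    have : p - n / 2 = n * (p / n) := by omega
    rw [this]
    have : p / n + 1 < M := by
      by_contra hc
      push Not at hc
      have := Nat.mul_le_mul_left n hc
      rw [mul_add] at this
      obtain ⟨c, hc⟩ := hev
      omega
    have := Nat.mul_le_mul_left n this
    simp only [Nat.succ_eq_add_one, mul_add] at this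
    omega
  have hVl : (wordCompl (alphaWord s (i + 1)) ++ wordCompl (alphaWord s (i + 1))).length = 2 * n := by
    rw [List.length_append, wordCompl_length, hl]; omega
  have hVD : ∀ t < 2 * n,
      (wordCompl (alphaWord s (i + 1)) ++ wordCompl (alphaWord s (i + 1))).getD t false
        = !(aFun s (i + 1) (t % n)) := by
    intro t ht
    by_cases h : t < n
    · rw [List.getD_append _ _ _ _ (by rw [wordCompl_length, hl]; exact h),
        wordCompl_getD _ _ (by omega), hA _ h, Nat.mod_eq_of_lt h]
    · push Not at h
      rw [List.getD_append_right _ _ _ _ (by rw [wordCompl_length, hl]; exact h),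
        wordCompl_length, hl,
        wordCompl_getD _ _ (by omega), hA _ (by omega), Nat.mod_eq_sub_mod h,
        Nat.mod_eq_of_lt (by omega)]
  refine ⟨hev, ?_, ?_⟩
  · intro h
    rw [block_iff _ _ _ _ (by omega) hl] at h
    rcases hkey g p (by
      intro t ht
      rw [← hg _ (by omega), ← hAj _ (by omega), h t ht, hA t ht]) with h1 | h1
    · left; exact Nat.dvd_of_mod_eq_zero h1.1
    · right
      refine ⟨h1.1, ?_⟩
      have hb := hlen2 h1.1
      rw [block_iff _ _ _ _ (by omega) hVl]
      intro t ht
      rw [hVD t ht, hAj _ (by omega), hg _ (by omega)]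
      rw [show p - n / 2 + t = t + n * (p / n) by omega, Nat.add_mul_mod_self_left,
        Nat.add_mul_div_left _ _ hpos]
      by_cases h2 : t < n
      · rw [Nat.div_eq_of_lt h2, zero_add, h1.2.1]; simp
      · rw [show t / n = 1 from Nat.div_eq_of_lt_le (by omega) (by omega), add_comm, h1.2.2]; simp
  · rintro ⟨h1, h⟩
    have hb := hlen2 h1
    rw [block_iff _ _ _ _ (by omega) hVl] at h
    rw [block_iff _ _ _ _ (by omega) hl]
    intro t ht
    have h2 := h (n / 2 + t) (by omega)
    rw [hVD _ (by omega), show p - n / 2 + (n / 2 + t) = p + t by omega] at h2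
    rw [h2, hA t ht]
    obtain ⟨c, hc⟩ := hev
    by_cases h3 : t < n / 2
    · rw [Nat.mod_eq_of_lt (by omega), add_comm (n / 2) t, hhalf t h3]; simp
    · rw [Nat.mod_eq_sub_mod (by omega), Nat.mod_eq_of_lt (by omega)]
      have := hhalf (t - n / 2) (by omega)
      rw [show t - n / 2 + n / 2 = t by omega] at this
      rw [this, show n / 2 + t - n = t - n / 2 by omega]
end

section
/- For every sequence (s_k) of positive integers and every i ≥ 1, each of the four words u ++ v with u, v ∈ { (α_i^{(s)})^{s_i}, (ᾱ_i^{(s)})^{s_i} } is a factor of α_{i+3}^{(s)}; in particular all four words belong to L^{(s)}. -/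
theorem wordPow_s (u : List Bool) (n : ℕ) : wordPow u (n + 1) = u ++ wordPow u n := by
  simp [wordPow, List.replicate_succ]

theorem wordPow_s' (u : List Bool) (n : ℕ) : wordPow u (n + 1) = wordPow u n ++ u := by
  simp [wordPow, List.replicate_succ']

theorem wordCompl_append (u v : List Bool) :
    wordCompl (u ++ v) = wordCompl u ++ wordCompl v := by
  simp [wordCompl]

theorem wordCompl_compl (u : List Bool) : wordCompl (wordCompl u) = u := by
  simp [wordCompl, Function.comp_def]

theorem wordCompl_pow (u : List Bool) (n : ℕ) :
    wordCompl (wordPow u n) = wordPow (wordCompl u) n := by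
  simp [wordCompl, wordPow, List.map_flatten]

theorem infix_step (X Y : List Bool) (t : ℕ) (ht : 0 < t) :
    (X ++ Y) <:+: (wordPow X t ++ wordPow Y t) ∧ X <:+: (wordPow X t ++ wordPow Y t) ∧
      Y <:+: (wordPow X t ++ wordPow Y t) := by
  obtain ⟨n, rfl⟩ : ∃ n, t = n + 1 := ⟨t - 1, by omega⟩
  have h : (X ++ Y) <:+: (wordPow X (n + 1) ++ wordPow Y (n + 1)) := by
    refine ⟨wordPow X n, wordPow Y n, ?_⟩
    rw [wordPow_s' X, wordPow_s Y]
    simp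
  exact ⟨h, (List.prefix_append X Y).isInfix.trans h, (List.suffix_append X Y).isInfix.trans h⟩

theorem four_words_in_langL (s : ℕ → ℕ) (hs : ∀ k, 0 < s k) (i : ℕ) (hi : 1 ≤ i)
    (u v : List Bool)
    (hu : u = wordPow (alphaWord s i) (s i) ∨ u = wordPow (wordCompl (alphaWord s i)) (s i))
    (hv : v = wordPow (alphaWord s i) (s i) ∨ v = wordPow (wordCompl (alphaWord s i)) (s i)) :
    (u ++ v) <:+: alphaWord s (i + 3) ∧ (u ++ v) ∈ langL s := by
  have key : (u ++ v) <:+: alphaWord s (i + 3) := by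
    obtain ⟨j, rfl⟩ : ∃ j, i = j + 1 := ⟨i - 1, by omega⟩
    have e1 : alphaWord s (j + 2) = wordPow (alphaWord s (j + 1)) (s (j + 1)) ++
      wordPow (wordCompl (alphaWord s (j + 1))) (s (j + 1)) := rfl
    have e2 : alphaWord s (j + 3) = wordPow (alphaWord s (j + 2)) (s (j + 2)) ++
      wordPow (wordCompl (alphaWord s (j + 2))) (s (j + 2)) := rfl
    have e3 : alphaWord s (j + 1 + 3) = wordPow (alphaWord s (j + 3)) (s (j + 3)) ++
      wordPow (wordCompl (alphaWord s (j + 3))) (s (j + 3)) := rfl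
    have c1 := congrArg wordCompl e1
    have c2 := congrArg wordCompl e2
    simp only [wordCompl_append, wordCompl_pow, wordCompl_compl] at c1 c2
    obtain ⟨-, p3, q3⟩ := infix_step (alphaWord s (j + 3)) (wordCompl (alphaWord s (j + 3)))
      (s (j + 3)) (hs _)
    rw [← e3] at p3 q3
    obtain ⟨m2, p2, q2⟩ := infix_step (alphaWord s (j + 2)) (wordCompl (alphaWord s (j + 2)))
      (s (j + 2)) (hs _)
    rw [← e2] at m2 p2 q2
    obtain ⟨n2, -, -⟩ := infix_step (wordCompl (alphaWord s (j + 2))) (alphaWord s (j + 2))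
      (s (j + 2)) (hs _)
    rw [← c2] at n2
    rw [c1, e1] at m2 n2
    rw [e1] at p2
    rw [c1] at q2
    generalize wordPow (alphaWord s (j + 1)) (s (j + 1)) = A at *
    generalize wordPow (wordCompl (alphaWord s (j + 1))) (s (j + 1)) = B at *
    rcases hu with hu | hu <;> rcases hv with hv | hv <;> rw [hu, hv]
    · exact List.IsInfix.trans ⟨B, B, by simp only [List.append_assoc]⟩ (n2.trans q3)
    · exact p2.trans p3
    · exact q2.trans p3
    · exact List.IsInfix.trans ⟨A, A, by simp only [List.append_assoc]⟩ (m2.trans p3)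
  exact ⟨key, i + 3, by omega, key⟩
end

section
/- If (s_k) and (t_k) are distinct sequences of positive integers, then there exists n such that Set.ncard {w ∈ L^{(s)} : |w| = n} ≠ Set.ncard {w ∈ L^{(t)} : |w| = n}; that is, distinct sequences yield languages with distinct counting (enumeration) functions. -/
lemma wc_append (x y : List Bool) : wordCompl (x ++ y) = wordCompl x ++ wordCompl y := by
  simp [wordCompl]

lemma wc_wc (x : List Bool) : wordCompl (wordCompl x) = x := by
  induction x with
  | nil => rfl
  | cons c x ih => simpa [wordCompl] using ih

lemma wc_length (x : List Bool) : (wordCompl x).length = x.length := by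
  simp [wordCompl]

lemma wc_flatten (B : List (List Bool)) : wordCompl B.flatten = (B.map wordCompl).flatten := by
  induction B with
  | nil => rfl
  | cons x B ih => simp [wc_append, ih]

lemma wc_infix {x y : List Bool} (h : x <:+: y) : wordCompl x <:+: wordCompl y := by
  obtain ⟨p, q, rfl⟩ := h
  exact ⟨wordCompl p, wordCompl q, by simp [wc_append]⟩

lemma wp_zero (x : List Bool) : wordPow x 0 = [] := by simp [wordPow]

lemma wp_one (x : List Bool) : wordPow x 1 = x := by simp [wordPow]

lemma wp_add (x : List Bool) (j k : ℕ) : wordPow x (j + k) = wordPow x j ++ wordPow x k := by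
  rw [wordPow, List.replicate_add, List.flatten_append]; rfl

lemma wp_succ (x : List Bool) (k : ℕ) : wordPow x (k + 1) = x ++ wordPow x k := by
  rw [add_comm, wp_add, wp_one]

lemma wp_succ2 (x : List Bool) (k : ℕ) : wordPow x (k + 1) = wordPow x k ++ x := by
  rw [wp_add, wp_one]

lemma wp_length (x : List Bool) (k : ℕ) : (wordPow x k).length = k * x.length := by
  simp [wordPow]

lemma wc_wp (x : List Bool) (k : ℕ) : wordCompl (wordPow x k) = wordPow (wordCompl x) k := by
  simp [wordPow, wc_flatten]

lemma alpha_succ (s : ℕ → ℕ) {k : ℕ} (hk : 1 ≤ k) : alphaWord s (k + 1) =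
    wordPow (alphaWord s k) (s k) ++ wordPow (wordCompl (alphaWord s k)) (s k) := by
  obtain ⟨j, rfl⟩ : ∃ j, k = j + 1 := ⟨k - 1, by omega⟩
  rfl

lemma alpha_half (s : ℕ → ℕ) {k : ℕ} (hk : 1 ≤ k) (hs : ∀ k, 0 < s k) :
    ∃ u, 1 ≤ u.length ∧ alphaWord s k = u ++ wordCompl u := by
  induction k, hk using Nat.le_induction with
  | base => exact ⟨[false], by simp, rfl⟩
  | succ k hk ih =>
    obtain ⟨u, hu, h⟩ := ih
    refine ⟨wordPow (alphaWord s k) (s k), ?_, ?_⟩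
    · rw [wp_length, h]
      have := hs k
      simp only [List.length_append]
      nlinarith
    · rw [alpha_succ s hk, wc_wp]

lemma pair_infix (s : ℕ → ℕ) (hs : ∀ k, 0 < s k) {k : ℕ} (hk : 1 ≤ k) :
    alphaWord s k ++ wordCompl (alphaWord s k) <:+: alphaWord s (k + 1) := by
  rw [alpha_succ s hk]
  obtain ⟨j, hj⟩ : ∃ j, s k = j + 1 := ⟨s k - 1, by have := hs k; omega⟩
  rw [hj]
  nth_rw 1 [wp_succ2]
  rw [wp_succ]
  exact ⟨wordPow (alphaWord s k) j, wordPow (wordCompl (alphaWord s k)) j, by simp⟩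

lemma alpha_mono (s : ℕ → ℕ) (hs : ∀ k, 0 < s k) {k m : ℕ} (hk : 1 ≤ k) (hm : k ≤ m) :
    alphaWord s k <:+: alphaWord s m := by
  induction m, hm using Nat.le_induction with
  | base => exact List.infix_rfl
  | succ m hm ih =>
    refine ih.trans (List.IsInfix.trans ?_ (pair_infix s hs (hk.trans hm)))
    exact (List.prefix_append _ _).isInfix

lemma langL_infix {s : ℕ → ℕ} {x y : List Bool} (h : y ∈ langL s) (hx : x <:+: y) :
    x ∈ langL s := by
  obtain ⟨i, hi, hy⟩ := h
  exact ⟨i, hi, hx.trans hy⟩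

lemma langL_compl {s : ℕ → ℕ} (hs : ∀ k, 0 < s k) {y : List Bool} (h : y ∈ langL s) :
    wordCompl y ∈ langL s := by
  obtain ⟨i, hi, hy⟩ := h
  refine ⟨i + 1, by omega, (wc_infix hy).trans (List.IsInfix.trans ?_ (pair_infix s hs hi))⟩
  exact (List.suffix_append _ _).isInfix

lemma alpha_blocks (s : ℕ → ℕ) {k : ℕ} (hk : 1 ≤ k) (c : List Bool)
    (hc : alphaWord s k = c ++ wordCompl c) (m : ℕ) :
    ∃ B : List (List Bool), (∀ x ∈ B, x = c ∨ x = wordCompl c) ∧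
      alphaWord s (k + m) = B.flatten := by
  induction m with
  | zero => exact ⟨[c, wordCompl c], by simp, by simp [hc]⟩
  | succ m ih =>
    obtain ⟨B, hB, h⟩ := ih
    refine ⟨(List.replicate (s (k + m)) B).flatten ++
      (List.replicate (s (k + m)) (B.map wordCompl)).flatten, ?_, ?_⟩
    · intro x hx
      simp only [List.mem_append, List.mem_flatten, List.mem_replicate] at hx
      rcases hx with ⟨l, ⟨_, rfl⟩, hx⟩ | ⟨l, ⟨_, rfl⟩, hx⟩
      · exact hB x hx
      · rw [List.mem_map] at hx
        obtain ⟨y, hy, rfl⟩ := hx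
        rcases hB y hy with rfl | rfl
        · right; rfl
        · left; exact wc_wc _
    · have key : ∀ (n : ℕ) (D : List (List Bool)),
          wordPow D.flatten n = (List.replicate n D).flatten.flatten := by
        intro n D
        induction n with
        | zero => simp [wordPow]
        | succ n ih => rw [wp_succ, ih, List.replicate_succ]; simp
      rw [← add_assoc, alpha_succ s (by omega), h, wc_flatten, key, key, List.flatten_append]

lemma flatten_drop_uniform (M : ℕ) (B : List (List Bool)) (hB : ∀ x ∈ B, x.length = M) (q : ℕ) :
    B.flatten.drop (q * M) = (B.drop q).flatten := by
  induction q generalizing B with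
  | zero => simp
  | succ q ih =>
    cases B with
    | nil => simp
    | cons x B =>
      have hx : x.length = M := hB x (by simp)
      rw [List.flatten_cons, List.drop_succ_cons, ← ih B (fun y hy => hB y (by simp [hy])),
        show (q + 1) * M = x.length + q * M by rw [hx]; ring, List.drop_append]
      simp

lemma flatten_take_uniform (M : ℕ) (B : List (List Bool)) (hB : ∀ x ∈ B, x.length = M) (q : ℕ) :
    B.flatten.take (q * M) = (B.take q).flatten := by
  induction q generalizing B with
  | zero => simp
  | succ q ih =>
    cases B with
    | nil => simp
    | cons x B =>
      have hx : x.length = M := hB x (by simp)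
      rw [List.flatten_cons, List.take_succ_cons, List.flatten_cons,
        ← ih B (fun y hy => hB y (by simp [hy])),
        show (q + 1) * M = x.length + q * M by rw [hx]; ring, List.take_append]
      simp

lemma block_window (M K : ℕ) (hM : 0 < M) (B : List (List Bool)) (hB : ∀ x ∈ B, x.length = M)
    (w : List Bool) (hw : w <:+: B.flatten) (hl : w.length ≤ M * K + 1) :
    ∃ q, w <:+: ((B.drop q).take (K + 1)).flatten := by
  obtain ⟨x, y, h⟩ := hw
  set q := x.length / M with hq
  have hdm : M * q + x.length % M = x.length := Nat.div_add_mod _ _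
  have hle : q * M ≤ x.length := Nat.div_mul_le_self _ _
  have hr : x.length % M < M := Nat.mod_lt _ hM
  refine ⟨q, ?_⟩
  rw [← flatten_take_uniform M _ (fun x hx => hB x (List.mem_of_mem_drop hx)),
    ← flatten_drop_uniform M _ hB, ← h]
  have e1 : (x ++ w ++ y).drop (q * M) = x.drop (q * M) ++ w ++ y := by
    rw [List.append_assoc, List.drop_append, show q * M - x.length = 0 by
      omega]
    simp
  rw [e1]
  have e2 : (x.drop (q * M) ++ w).length ≤ (K + 1) * M := by
    rw [List.length_append, List.length_drop, ← Nat.sub_add_comm hle]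
    rw [Nat.sub_le_iff_le_add]
    nlinarith
  have e3 : x.drop (q * M) ++ w <+: (x.drop (q * M) ++ w ++ y).take ((K + 1) * M) :=
    List.prefix_take_iff.2 ⟨List.prefix_append _ _, e2⟩
  exact (List.suffix_append _ _).isInfix.trans e3.isInfix

lemma pow_window (M K : ℕ) (hM : 0 < M) (x y w : List Bool) (hx : x.length = M)
    (hy : y.length = M) (j k : ℕ) (hw : w <:+: wordPow x j ++ wordPow y k)
    (hl : w.length ≤ M * K + 1) :
    ∃ j' k', j' + k' ≤ K + 1 ∧ w <:+: wordPow x j' ++ wordPow y k' := by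
  have h1 : wordPow x j ++ wordPow y k = (List.replicate j x ++ List.replicate k y).flatten := by
    simp [wordPow]
  rw [h1] at hw
  obtain ⟨q, hq⟩ := block_window M K hM _ (by
    intro z hz
    simp only [List.mem_append, List.mem_replicate] at hz
    rcases hz with ⟨_, rfl⟩ | ⟨_, rfl⟩ <;> assumption) w hw hl
  rw [List.drop_append, List.take_append, List.drop_replicate, List.drop_replicate,
    List.take_replicate, List.take_replicate, List.flatten_append] at hq
  refine ⟨_, _, ?_, hq⟩
  simp only [List.length_replicate]
  omega

lemma langL_two (t : ℕ → ℕ) (ht : ∀ k, 0 < t k) {i : ℕ} (hi : 1 ≤ i) (w : List Bool)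
    (hw : w ∈ langL t) (hl : w.length ≤ (alphaWord t i).length * t i) :
    ∃ j k, w <:+: wordPow (alphaWord t i) j ++ wordPow (wordCompl (alphaWord t i)) k ∨
      w <:+: wordPow (wordCompl (alphaWord t i)) j ++ wordPow (alphaWord t i) k := by
  obtain ⟨u, hu, hau⟩ := alpha_half t hi ht
  have hL : 0 < (alphaWord t i).length := by rw [hau, List.length_append]; omega
  obtain ⟨m, hm, hwm⟩ := hw
  have hw2 : w <:+: alphaWord t (i + 1 + m) := hwm.trans (alpha_mono t ht hm (by omega))
  set a := alphaWord t i with ha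
  set Y := t i with hY
  obtain ⟨B, hB, hBf⟩ := alpha_blocks t (k := i + 1) (by omega) (wordPow a Y)
    (by rw [alpha_succ t hi, wc_wp]) m
  rw [hBf] at hw2
  have hBl : ∀ x ∈ B, x.length = Y * a.length := by
    intro x hx
    rcases hB x hx with rfl | rfl
    · rw [wp_length]
    · rw [wc_length, wp_length]
  obtain ⟨q, hq⟩ := block_window (Y * a.length) 1 (Nat.mul_pos (ht i) hL) B hBl w hw2
    (by rw [mul_comm Y]; omega)
  have hD : ∀ x ∈ B.drop q, x = wordPow a Y ∨ x = wordPow (wordCompl a) Y := by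
    intro x hx
    rw [← wc_wp]
    exact hB x (List.mem_of_mem_drop hx)
  match hE : B.drop q with
  | [] => rw [hE] at hq; exact ⟨0, 0, Or.inl (by simpa [wp_zero] using hq)⟩
  | [x] =>
    rw [hE] at hq hD
    rcases hD x (by simp) with rfl | rfl
    · exact ⟨Y, 0, Or.inl (by simpa [wp_zero] using hq)⟩
    · exact ⟨0, Y, Or.inl (by simpa [wp_zero] using hq)⟩
  | x :: y :: r =>
    rw [hE] at hq hD
    have hq' : w <:+: x ++ y := by simpa using hq
    rcases hD x (by simp) with rfl | rfl <;> rcases hD y (by simp) with rfl | rfl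
    · exact ⟨Y + Y, 0, Or.inl (by simpa [wp_zero, wp_add] using hq')⟩
    · exact ⟨Y, Y, Or.inl hq'⟩
    · exact ⟨Y, Y, Or.inr hq'⟩
    · exact ⟨0, Y + Y, Or.inl (by simpa [wp_zero, wp_add] using hq')⟩

lemma wp_le_prefix (x : List Bool) {j k : ℕ} (h : j ≤ k) : ∃ z, wordPow x k = wordPow x j ++ z := by
  obtain ⟨d, rfl⟩ := Nat.exists_eq_add_of_le h
  exact ⟨_, wp_add x j d⟩

lemma wp_le_suffix (x : List Bool) {j k : ℕ} (h : j ≤ k) : ∃ z, wordPow x k = z ++ wordPow x j := by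
  obtain ⟨d, rfl⟩ := Nat.exists_eq_add_of_le h
  exact ⟨wordPow x d, by rw [← wp_add, add_comm]⟩

lemma wp_pair_mono (x y : List Bool) {j k j' k' : ℕ} (h : j ≤ j') (h' : k ≤ k') :
    wordPow x j ++ wordPow y k <:+: wordPow x j' ++ wordPow y k' := by
  obtain ⟨z, hz⟩ := wp_le_suffix x h
  obtain ⟨z', hz'⟩ := wp_le_prefix y h'
  rw [hz, hz']
  exact ⟨z, z', by simp⟩

lemma cddc_mem (s : ℕ → ℕ) (hs : ∀ k, 0 < s k) {i : ℕ} (hi : 1 ≤ i) (c : List Bool)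
    (hc : c = wordPow (alphaWord s i) (s i)) :
    c ++ (wordCompl c ++ (wordCompl c ++ c)) ∈ langL s := by
  have h1 : alphaWord s (i + 1) = c ++ wordCompl c := by rw [alpha_succ s hi, hc, wc_wp]
  refine ⟨i + 2, by omega, ?_⟩
  have := pair_infix s hs (k := i + 1) (by omega)
  rw [h1, wc_append, wc_wc, List.append_assoc] at this
  exact this

lemma dcd_mem (s : ℕ → ℕ) (hs : ∀ k, 0 < s k) {i : ℕ} (hi : 1 ≤ i) (c : List Bool)
    (hc : c = wordPow (alphaWord s i) (s i)) :
    wordCompl c ++ (c ++ wordCompl c) ∈ langL s := by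
  have h1 : alphaWord s (i + 1) = c ++ wordCompl c := by rw [alpha_succ s hi, hc, wc_wp]
  have h2 := alpha_succ s (k := i + 1) (by omega)
  rw [h1, wc_append, wc_wc] at h2
  by_cases hp : s (i + 1) = 1
  · rw [hp, wp_one, wp_one] at h2
    have := pair_infix s hs (k := i + 2) (by omega)
    rw [h2] at this
    refine ⟨i + 2 + 1, by omega, List.IsInfix.trans ?_ this⟩
    refine ⟨c ++ wordCompl c, c ++ c ++ wordCompl c, ?_⟩
    simp [wc_append, wc_wc]
  · obtain ⟨d, hd⟩ : ∃ d, s (i + 1) = d + 1 + 1 :=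
      ⟨s (i + 1) - 2, by have := hs (i + 1); omega⟩
    refine ⟨i + 2, by omega, ?_⟩
    rw [h2, hd, wp_succ (wordCompl c ++ c), wp_succ (wordCompl c ++ c)]
    exact ⟨wordPow (c ++ wordCompl c) (d + 1 + 1), c ++ wordPow (wordCompl c ++ c) d, by simp⟩

lemma jk_mem (s : ℕ → ℕ) (hs : ∀ k, 0 < s k) {i : ℕ} (hi : 1 ≤ i) (w : List Bool) (j k : ℕ)
    (hw : w <:+: wordPow (alphaWord s i) j ++ wordPow (wordCompl (alphaWord s i)) k)
    (hjk : (j ≤ s i ∧ k ≤ 2 * s i) ∨ (j ≤ 2 * s i ∧ k ≤ s i)) : w ∈ langL s := by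
  set a := alphaWord s i with ha
  have hm := cddc_mem s hs hi (wordPow a (s i)) rfl
  rcases hjk with ⟨h1, h2⟩ | ⟨h1, h2⟩
  · refine langL_infix hm (hw.trans ((wp_pair_mono a _ h1 h2).trans ?_))
    rw [wc_wp, two_mul, wp_add]
    exact ⟨[], wordPow a (s i), by simp⟩
  · have hm' := langL_compl hs hm
    refine langL_infix hm' (hw.trans ((wp_pair_mono a _ h1 h2).trans ?_))
    rw [wc_append, wc_append, wc_append, wc_wc, wc_wp, two_mul, wp_add]
    exact ⟨wordPow (wordCompl a) (s i), [], by simp⟩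

lemma cube (s : ℕ → ℕ) (hs : ∀ k, 0 < s k) {i : ℕ} (hi : 1 ≤ i) (w : List Bool)
    (hw : w <:+: wordPow (alphaWord s i) 3) (hl : w.length = (alphaWord s i).length + 2) :
    w <:+: wordPow (alphaWord s i) 2 ∨ w <:+: wordPow (wordCompl (alphaWord s i)) 2 := by
  obtain ⟨u, hu, hau⟩ := alpha_half s hi hs
  rw [hau] at hw hl ⊢
  have hl2 : (wordCompl u).length = u.length := wc_length u
  have e : wordPow (u ++ wordCompl u) 3 =
      [u, wordCompl u, u, wordCompl u, u, wordCompl u].flatten := by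
    simp [wordPow]
  rw [e] at hw
  obtain ⟨q, hq⟩ := block_window u.length 3 hu _ (by simp [hl2]) w hw (by
    rw [hl, List.length_append, hl2]; omega)
  have e1 : wordPow (u ++ wordCompl u) 2 = u ++ (wordCompl u ++ (u ++ wordCompl u)) := by
    simp [wordPow]
  have e2 : wordPow (wordCompl (u ++ wordCompl u)) 2 =
      wordCompl u ++ (u ++ (wordCompl u ++ u)) := by
    simp [wordPow, wc_append, wc_wc]
  rw [e1, e2]
  match q with
  | 0 => left; simpa using hq
  | 1 => right; simpa using hq
  | 2 => left; simpa using hq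
  | 3 => right; refine hq.trans ⟨[], u, by simp⟩
  | 4 => left; refine hq.trans ⟨[], u ++ wordCompl u, by simp⟩
  | 5 => right; refine hq.trans ⟨[], u ++ wordCompl u ++ u, by simp⟩
  | (n + 6) => left; refine hq.trans ⟨[], u ++ wordCompl u ++ u ++ wordCompl u, by simp⟩

lemma jk_sum (s : ℕ → ℕ) (hs : ∀ k, 0 < s k) {i : ℕ} (hi : 1 ≤ i) (w : List Bool) (j k : ℕ)
    (hw : w <:+: wordPow (alphaWord s i) j ++ wordPow (wordCompl (alphaWord s i)) k)
    (hl : w.length = (alphaWord s i).length * s i + 2) (hjk : j + k ≤ s i + 2) :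
    w ∈ langL s := by
  by_cases h : (j ≤ s i ∧ k ≤ 2 * s i) ∨ (j ≤ 2 * s i ∧ k ≤ s i)
  · exact jk_mem s hs hi w j k hw h
  · have h0 := hs i
    have hX : s i = 1 := by omega
    have key : ∀ v, v <:+: wordPow (alphaWord s i) 3 →
        v.length = (alphaWord s i).length + 2 → v ∈ langL s := by
      intro v hv hvl
      rcases cube s hs hi v hv hvl with h | h
      · exact jk_mem s hs hi v 2 0 (by simpa [wp_zero] using h) (by omega)
      · exact jk_mem s hs hi v 0 2 (by simpa [wp_zero] using h) (by omega)
    rw [hX] at hl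
    have : (j = 3 ∧ k = 0) ∨ (j = 0 ∧ k = 3) := by omega
    rcases this with ⟨rfl, rfl⟩ | ⟨rfl, rfl⟩
    · exact key w (by simpa [wp_zero] using hw) (by omega)
    · have := wc_infix hw
      simp only [wp_zero, List.nil_append, wc_wp, wc_wc] at this
      have := langL_compl hs (key _ this (by rw [wc_length]; omega))
      rwa [wc_wc] at this

lemma sub_lang (s t : ℕ → ℕ) (hs : ∀ k, 0 < s k) (ht : ∀ k, 0 < t k) {i : ℕ} (hi : 1 ≤ i)
    (hst : alphaWord s i = alphaWord t i) (hlt : s i < t i) (w : List Bool) (hw : w ∈ langL t)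
    (hl : w.length = (alphaWord s i).length * s i + 2) : w ∈ langL s := by
  obtain ⟨u, hu, hau⟩ := alpha_half s hi hs
  have hL : 2 ≤ (alphaWord s i).length := by rw [hau, List.length_append, wc_length]; omega
  have hl' : w.length ≤ (alphaWord s i).length * (s i + 1) := by
    rw [hl, mul_add]; omega
  obtain ⟨j, k, h⟩ := langL_two t ht hi w hw (by
    rw [← hst]; exact hl'.trans (Nat.mul_le_mul_left _ hlt))
  rw [← hst] at h
  rcases h with h | h
  · obtain ⟨j', k', h1, h2⟩ := pow_window _ (s i + 1) (by omega) _ _ w rfl (wc_length _) j k h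
      (by omega)
    exact jk_sum s hs hi w j' k' h2 hl (by omega)
  · obtain ⟨j', k', h1, h2⟩ := pow_window _ (s i + 1) (by omega) _ _ w (wc_length _) rfl j k h
      (by omega)
    have h3 := wc_infix h2
    rw [wc_append, wc_wp, wc_wp, wc_wc] at h3
    have := langL_compl hs (jk_sum s hs hi _ j' k' h3 (by rw [wc_length]; exact hl) (by omega))
    rwa [wc_wc] at this

lemma shift_mul (A : ℕ → Bool) (g : ℕ) (e : Bool) (h : ∀ n, A (n + g) = (e ^^ A n)) (k : ℕ) :
    ∀ n, A (n + k * g) = ((e && decide (k % 2 = 1)) ^^ A n) := by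
  induction k with
  | zero => intro n; simp
  | succ k ih =>
    intro n
    rw [show n + (k + 1) * g = n + k * g + g by ring, h, ih]
    rcases Nat.mod_two_eq_zero_or_one k with h0 | h0
    · have : (k + 1) % 2 = 1 := by omega
      cases e <;> simp [h0, this]
    · have : (k + 1) % 2 = 0 := by omega
      cases e <;> simp [h0, this]

lemma no_shift (A : ℕ → Bool) (M q : ℕ) (e : Bool) (hq : 0 < q) (hqL : q < 2 * M)
    (hL : ∀ n, A (n + 2 * M) = !A n) (hA : ∀ n, A (n + q) = (e ^^ A n))
    (hM : ∀ n < M, A (n + M) = !A n) : False := by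
  classical
  have hex : ∃ g, 0 < g ∧ ∃ e, ∀ n, A (n + g) = (e ^^ A n) := ⟨q, hq, e, hA⟩
  obtain ⟨g, ⟨hg0, e', hg⟩, hgq, hmin⟩ : ∃ g, (0 < g ∧ ∃ e, ∀ n, A (n + g) = (e ^^ A n)) ∧ g ≤ q ∧
      ∀ m < g, ¬ (0 < m ∧ ∃ e, ∀ n, A (n + m) = (e ^^ A n)) :=
    ⟨Nat.find hex, Nat.find_spec hex, Nat.find_min' hex ⟨hq, e, hA⟩,
      fun m hm => Nat.find_min hex hm⟩
  set m := 2 * M / g with hm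
  have hdm : m * g + 2 * M % g = 2 * M := by rw [mul_comm]; exact Nat.div_add_mod _ _
  have hr : 2 * M % g = 0 := by
    by_contra hne
    refine hmin _ (Nat.mod_lt _ hg0) ⟨Nat.pos_of_ne_zero hne, ((e' && decide (m % 2 = 1)) ^^ true), ?_⟩
    intro n
    have h1 := shift_mul A g e' hg m (n + 2 * M % g)
    rw [show n + 2 * M % g + m * g = n + 2 * M by omega, hL] at h1
    generalize (e' && decide (m % 2 = 1)) = c at h1 ⊢
    generalize A (n + 2 * M % g) = y at h1 ⊢
    generalize A n = x at h1 ⊢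
    revert h1; revert x y c; decide
  rw [hr, add_zero] at hdm
  have h1 := shift_mul A g e' hg m 0
  rw [hdm, hL] at h1
  have h2 : e' = true ∧ m % 2 = 1 := by
    have h3 : (e' && decide (m % 2 = 1)) = true := by
      generalize (e' && decide (m % 2 = 1)) = c at h1 ⊢
      generalize A 0 = x at h1
      revert h1; revert x c; decide
    simpa using h3
  obtain ⟨rfl, hodd⟩ := h2
  obtain ⟨k, hk⟩ : ∃ k, m = 2 * k + 1 := ⟨m / 2, by omega⟩
  have hk0 : k ≠ 0 := by
    rintro rfl
    rw [hk] at hdm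
    omega
  rw [hk] at hdm
  have hdm2 : 2 * (k * g) + g = 2 * M := by rw [← hdm]; ring
  obtain ⟨h, rfl⟩ : ∃ h, g = 2 * h := ⟨g / 2, by omega⟩
  have hMk : h + k * (2 * h) = M := by omega
  have hkh : 0 < k * (2 * h) := Nat.mul_pos (Nat.pos_of_ne_zero hk0) hg0
  have a1 := hM 0 (by omega)
  have a2 := shift_mul A _ _ hg k h
  have a3 := hM h (by omega)
  have a4 := shift_mul A _ _ hg (k + 1) 0
  rw [zero_add] at a1
  rw [hMk] at a2
  rw [show 0 + (k + 1) * (2 * h) = h + M by rw [← hMk]; ring] at a4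
  rw [a1] at a2
  rw [a3] at a4
  rcases Nat.mod_two_eq_zero_or_one k with h0 | h0
  · have : (k + 1) % 2 = 1 := by omega
    simp [h0, this] at a2 a4
    simp [a4] at a2
  · have : (k + 1) % 2 = 0 := by omega
    simp [h0, this] at a2 a4
    simp [a4] at a2

lemma core (P : ℕ → Bool) (M X j r : ℕ) (e : Bool) (hM0 : 0 < M) (hX : 1 ≤ X)
    (hP : ∀ n, P (n + 2 * M) = P n) (hM : ∀ n < M, P (n + M) = !P n) (f : ℕ → Bool)
    (h0 : f 0 = (e ^^ !P (2 * M - 1))) (h1 : ∀ n < X * (2 * M), f (n + 1) = (e ^^ P n))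
    (h2 : f (X * (2 * M) + 1) = (e ^^ !P 0))
    (hz : ∀ n < X * (2 * M) + 2, f n = if n + r < j * (2 * M) then P (n + r) else !P (n + r)) :
    False := by
  obtain ⟨x, rfl⟩ : ∃ x, X = x + 1 := ⟨X - 1, by omega⟩
  have hXL : (x + 1) * (2 * M) = x * (2 * M) + 2 * M := by ring
  rw [hXL] at h1 h2 hz
  have b0 := hz 0 (by omega)
  have b1 := hz (2 * M) (by omega)
  have b2 := h1 (2 * M - 1) (by omega)
  rw [show 2 * M - 1 + 1 = 2 * M by omega] at b2
  rw [h0] at b0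
  rw [b2, show 2 * M + r = 0 + r + 2 * M by ring, hP] at b1
  have c1 : r < j * (2 * M) ∧ j * (2 * M) ≤ r + 2 * M := by
    by_contra hcon
    by_cases hlt : r < j * (2 * M)
    · have : r + 2 * M < j * (2 * M) := by omega
      simp only [zero_add, hlt, this, if_true] at b0 b1
      rw [← b1] at b0
      revert b0
      cases e <;> simp
    · have : ¬ r + 2 * M < j * (2 * M) := by omega
      simp only [zero_add, hlt, this, if_false] at b0 b1
      rw [← b1] at b0
      revert b0
      cases e <;> simp
  have d0 := hz (x * (2 * M) + 1) (by omega)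
  have d1 := hz (x * (2 * M) + 2 * M + 1) (by omega)
  have d2 := h1 (x * (2 * M)) (by omega)
  have hPm : ∀ y, P (y * (2 * M)) = P 0 := by
    intro y
    induction y with
    | zero => simp
    | succ y ih => rw [Nat.succ_mul, hP, ih]
  rw [hPm] at d2
  rw [h2, show x * (2 * M) + 2 * M + 1 + r = x * (2 * M) + 1 + r + 2 * M by ring, hP] at d1
  rw [d2] at d0
  have c2 : x * (2 * M) + 1 + r < j * (2 * M) := by
    by_contra hlt
    have : ¬ x * (2 * M) + 1 + r + 2 * M < j * (2 * M) := by omega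
    simp only [hlt, this, if_false] at d0 d1
    rw [← d0] at d1
    revert d1
    cases e <;> simp
  have hx : x = 0 := by
    by_contra hne
    have : 2 * M ≤ x * (2 * M) := Nat.le_mul_of_pos_left _ (Nat.pos_of_ne_zero hne)
    omega
  subst hx
  simp only [zero_mul, zero_add] at h1 hz c2
  obtain ⟨i, rfl⟩ : ∃ i, j = i + 1 := ⟨j - 1, by
    have : j ≠ 0 := by rintro rfl; omega
    omega⟩
  rw [Nat.add_mul i 1, one_mul] at hz c1 c2
  obtain ⟨q, hq⟩ : ∃ q, r + 1 = q + i * (2 * M) := ⟨r + 1 - i * (2 * M), by omega⟩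
  have hPi : ∀ y n, P (n + y * (2 * M)) = P n := by
    intro y
    induction y with
    | zero => simp
    | succ y ih => intro n; rw [Nat.succ_mul, ← add_assoc, hP, ih]
  have key : ∀ n < 2 * M, (e ^^ P n) = if n + q < 2 * M then P (n + q) else !P (n + q) := by
    intro n hn
    have := hz (n + 1) (by omega)
    rw [h1 n hn, show n + 1 + r = n + q + i * (2 * M) by omega, hPi] at this
    rw [this]
    by_cases hc : n + q < 2 * M
    · rw [if_pos hc, if_pos (by omega)]
    · rw [if_neg hc, if_neg (by omega)]
  have hAL : ∀ n, (P (n + 2 * M) ^^ decide ((n + 2 * M) / (2 * M) % 2 = 1)) =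
      !(P n ^^ decide (n / (2 * M) % 2 = 1)) := by
    intro n
    rw [hP, Nat.add_div_right _ (by omega)]
    rcases Nat.mod_two_eq_zero_or_one (n / (2 * M)) with h | h
    · have : (n / (2 * M)).succ % 2 = 1 := by omega
      simp [h, this]
    · have : (n / (2 * M)).succ % 2 = 0 := by omega
      simp [h, this]
  refine no_shift (fun n => P n ^^ decide (n / (2 * M) % 2 = 1)) M q e (by omega) (by omega)
    hAL ?_ ?_
  · intro n
    induction n using Nat.strong_induction_on with
    | _ n ih =>
      by_cases hn : n < 2 * M
      · have hk := key n hn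
        rw [Nat.div_eq_of_lt hn]
        by_cases hc : n + q < 2 * M
        · rw [if_pos hc] at hk
          rw [Nat.div_eq_of_lt hc, ← hk]
          simp
        · rw [if_neg hc] at hk
          have : (n + q) / (2 * M) = 1 := by
            rw [Nat.div_eq_iff (by omega)]; omega
          rw [this]
          simpa using hk.symm
      · obtain ⟨k, rfl⟩ : ∃ k, n = k + 2 * M := ⟨n - 2 * M, by omega⟩
        have := ih k (by omega)
        rw [show k + 2 * M + q = k + q + 2 * M by ring, hAL, hAL, this]
        simp
  · intro n hn
    rw [hM n hn, Nat.div_eq_of_lt (by omega), Nat.div_eq_of_lt (by omega)]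
    simp

lemma wp_getD (a : List Bool) (j n : ℕ) (h : n < j * a.length) :
    (wordPow a j).getD n false = a.getD (n % a.length) false := by
  induction j generalizing n with
  | zero => omega
  | succ j ih =>
    rw [wp_succ]
    by_cases hn : n < a.length
    · rw [List.getD_append _ _ _ _ hn, Nat.mod_eq_of_lt hn]
    · rw [List.getD_append_right _ _ _ _ (by omega), ih _ (by rw [Nat.succ_mul] at h; omega)]
      rw [← Nat.mod_eq_sub_mod (by omega)]

lemma wc_getD (a : List Bool) (n : ℕ) (h : n < a.length) :
    (wordCompl a).getD n false = !a.getD n false := by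
  rw [List.getD_eq_getElem _ _ h, List.getD_eq_getElem _ _ (by rwa [wc_length])]
  simp [wordCompl]

lemma pair_getD (a : List Bool) (j k n : ℕ) (h : n < j * a.length + k * a.length) :
    (wordPow a j ++ wordPow (wordCompl a) k).getD n false =
      if n < j * a.length then a.getD (n % a.length) false else !a.getD (n % a.length) false := by
  by_cases hn : n < j * a.length
  · rw [if_pos hn, List.getD_append _ _ _ _ (by rwa [wp_length]), wp_getD _ _ _ hn]
  · rw [if_neg hn, List.getD_append_right _ _ _ _ (by rw [wp_length]; omega), wp_length,
      ← wc_wp, wc_getD _ _ (by rw [wp_length]; omega), wp_getD _ _ _ (by omega)]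
    congr 2
    rw [mul_comm, Nat.sub_mul_mod]
    rw [mul_comm]; omega

/-- The witness word. -/
def wit (a : List Bool) (X : ℕ) : List Bool :=
  [!a.getD (a.length - 1) false] ++ (wordPow a X ++ [!a.getD 0 false])

lemma wit_length (a : List Bool) (X : ℕ) : (wit a X).length = X * a.length + 2 := by
  simp [wit, wp_length]

lemma wit_not (u a : List Bool) (X j k : ℕ) (e : Bool) (hu : 1 ≤ u.length) (ha : a = u ++ wordCompl u)
    (hX : 1 ≤ X) (w : List Bool) (hwl : w.length = X * a.length + 2)
    (hw : ∀ n < w.length, w.getD n false = (e ^^ (wit a X).getD n false))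
    (h : w <:+: wordPow a j ++ wordPow (wordCompl a) k) : False := by
  have hal : a.length = 2 * u.length := by rw [ha, List.length_append, wc_length]; ring
  obtain ⟨x, y, hxy⟩ := h
  have hlen := congrArg List.length hxy
  simp only [List.length_append, wp_length, wc_length] at hlen
  have hXL : a.length ≤ X * a.length := Nat.le_mul_of_pos_left _ hX
  refine core (fun n => a.getD (n % a.length) false) u.length X j x.length e hu hX ?_ ?_
    (fun n => w.getD n false) ?_ ?_ ?_ ?_
  · intro n
    simp [← hal]
  · intro n hn
    rw [Nat.mod_eq_of_lt (by omega), Nat.mod_eq_of_lt (by omega)]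
    rw [ha, List.getD_append _ _ _ _ hn, List.getD_append_right _ _ _ _ (by omega),
      wc_getD _ _ (by omega)]
    simp
  · rw [hw 0 (by omega), ← hal, Nat.mod_eq_of_lt (by omega)]
    simp [wit]
  · intro n hn
    rw [← hal] at hn
    rw [hw _ (by omega)]
    congr 1
    rw [wit, List.getD_append_right _ _ _ _ (by simp)]
    rw [List.getD_append _ _ _ _ (by simpa [wp_length] using hn), wp_getD _ _ _ (by simpa using hn)]
    simp
  · rw [← hal, hw _ (by omega)]
    congr 1
    rw [wit, List.getD_append_right _ _ _ _ (by simp),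
      List.getD_append_right _ _ _ _ (by simp [wp_length])]
    simp [wp_length]
  · intro n hn
    rw [← hal] at hn ⊢
    rw [← pair_getD a j k _ (by omega), ← hxy, List.getD_append _ _ _ _ (by
      rw [List.length_append]; omega), List.getD_append_right _ _ _ _ (by omega)]
    simp

lemma wit_mem (s : ℕ → ℕ) (hs : ∀ k, 0 < s k) {i : ℕ} (hi : 1 ≤ i) :
    wit (alphaWord s i) (s i) ∈ langL s := by
  have h := dcd_mem s hs hi _ rfl
  obtain ⟨u, hu, hau⟩ := alpha_half s hi hs
  have hL : 2 ≤ (alphaWord s i).length := by rw [hau, List.length_append, wc_length]; omega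
  refine langL_infix h ?_
  set a := alphaWord s i with ha
  obtain ⟨d, hd⟩ : ∃ d, s i = d + 1 := ⟨s i - 1, by have := hs i; omega⟩
  have hb : ∀ b : List Bool, b.length = a.length → ∃ p, b = p ++ [b.getD (a.length - 1) false] := by
    intro b hb
    have hne : b ≠ [] := by rintro rfl; simp at hb; omega
    refine ⟨b.dropLast, ?_⟩
    rw [List.getD_eq_getElem _ _ (by omega)]
    conv_lhs => rw [← List.dropLast_append_getLast hne]
    simp [List.getLast_eq_getElem, hb]
  have hb2 : ∀ b : List Bool, b.length = a.length → ∃ p, b = [b.getD 0 false] ++ p := by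
    intro b hb
    cases b with
    | nil => simp at hb; omega
    | cons x b => exact ⟨b, by simp⟩
  obtain ⟨p, hp⟩ := hb _ (wc_length a)
  obtain ⟨p', hp'⟩ := hb2 _ (wc_length a)
  rw [wc_getD _ _ (by omega)] at hp hp'
  have e1 : wordCompl (wordPow a (s i)) =
      (wordPow (wordCompl a) d ++ p) ++ [!a.getD (a.length - 1) false] := by
    rw [wc_wp, hd, wp_succ2, List.append_assoc, ← hp]
  have e2 : wordCompl (wordPow a (s i)) =
      [!a.getD 0 false] ++ (p' ++ wordPow (wordCompl a) d) := by
    rw [wc_wp, hd, wp_succ, ← List.append_assoc, ← hp']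
  refine ⟨wordPow (wordCompl a) d ++ p, p' ++ wordPow (wordCompl a) d, ?_⟩
  nth_rw 2 [e2]
  rw [e1, wit]
  simp

lemma alpha_congr (s t : ℕ → ℕ) (i : ℕ) (h : ∀ k, 1 ≤ k → k < i → s k = t k) :
    ∀ k, k ≤ i → alphaWord s k = alphaWord t k := by
  intro k
  induction k with
  | zero => intro _; rfl
  | succ k ih =>
    intro hk
    by_cases h0 : k = 0
    · subst h0; rfl
    · rw [alpha_succ s (by omega), alpha_succ t (by omega), ih (by omega), h k (by omega) (by omega)]

lemma main_lt (s t : ℕ → ℕ) (hs : ∀ k, 0 < s k) (ht : ∀ k, 0 < t k) {i : ℕ} (hi : 1 ≤ i)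
    (hst : alphaWord s i = alphaWord t i) (hlt : s i < t i) :
    ∃ n, Set.ncard {w ∈ langL t | w.length = n} < Set.ncard {w ∈ langL s | w.length = n} := by
  obtain ⟨u, hu, hau⟩ := alpha_half s hi hs
  have hL : 2 ≤ (alphaWord s i).length := by rw [hau, List.length_append, wc_length]; omega
  refine ⟨(alphaWord s i).length * s i + 2, Set.ncard_lt_ncard ?_ ?_⟩
  · have hsub : {w ∈ langL t | w.length = (alphaWord s i).length * s i + 2} ⊆
        {w ∈ langL s | w.length = (alphaWord s i).length * s i + 2} := (fun w hw => ⟨sub_lang s t hs ht hi hst hlt w hw.1 hw.2, hw.2⟩)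
    rw [Set.ssubset_iff_of_subset hsub]
    refine ⟨wit (alphaWord s i) (s i), ⟨wit_mem s hs hi, by rw [wit_length, mul_comm]⟩, ?_⟩
    rintro ⟨hmem, hl⟩
    obtain ⟨j, k, h⟩ := langL_two t ht hi _ hmem (by
      rw [← hst, hl]
      calc _ ≤ (alphaWord s i).length * (s i + 1) := by rw [mul_add]; omega
        _ ≤ _ := Nat.mul_le_mul_left _ hlt)
    rw [← hst] at h
    rcases h with h | h
    · exact wit_not u _ (s i) j k false hu hau (hs i) _ (wit_length _ _) (by simp) h
    · have h3 := wc_infix h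
      rw [wc_append, wc_wp, wc_wp, wc_wc] at h3
      refine wit_not u _ (s i) j k true hu hau (hs i) _ (by rw [wc_length, wit_length]) ?_ h3
      intro n hn
      rw [wc_length] at hn
      rw [wc_getD _ _ hn]
      simp
  · exact (List.finite_length_eq Bool _).subset (fun w hw => hw.2)

theorem langL_distinct_counting (s t : ℕ → ℕ) (hs : ∀ k, 0 < s k) (ht : ∀ k, 0 < t k)
    (hne : ∃ i, 1 ≤ i ∧ s i ≠ t i) :
    ∃ n, Set.ncard {w ∈ langL s | w.length = n} ≠
      Set.ncard {w ∈ langL t | w.length = n} := by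
  classical
  have hex := hne
  obtain ⟨hi, hd⟩ := Nat.find_spec hex
  have hmin : ∀ k, 1 ≤ k → k < Nat.find hex → s k = t k := by
    intro k hk hlt
    by_contra hc
    exact Nat.find_min hex hlt ⟨hk, hc⟩
  have hst := alpha_congr s t _ hmin _ le_rfl
  rcases lt_or_gt_of_ne hd with h | h
  · obtain ⟨n, hn⟩ := main_lt s t hs ht hi hst h
    exact ⟨n, hn.ne'⟩
  · obtain ⟨n, hn⟩ := main_lt t s ht hs hi hst.symm h
    exact ⟨n, hn.ne⟩
end
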